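/- arXiv:1507.08090 — 2 statements merged into one kernel-verified Lean document; each statement's English description precedes it below -/
import Mathlib

section
/- Assume R : ℝ² → ℝ satisfies the regularity hypothesis (reg), that lim_{|x|→∞} R(x)|x|^{4−η} exists and lies in (0,+∞) for some η > 4, and that there exist β, δ > 0 such that |∇R(x)| ≥ β for all x ∈ {x ∈ ℝ² : |R(x)| ≤ δ} \ (𝒬)^r. Let u be a solution of −Δu = R e^u on ℝ² with u(x) = −η log|x| + O(1) as |x| → ∞, and suppose u ≤ C on {x ∈ ℝ² : R(x) ≤ ε} \ (𝒬)^r for constants ε, C > 0 as produced by the a priori estimate away from 𝒬. Then u(x) ≤ C for every x ∈ (𝒬⁻)^r as well. -/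
open MeasureTheory Real Topology Filter Metric

noncomputable section

/-- The Euclidean plane. -/
abbrev R2 : Type := EuclideanSpace ℝ (Fin 2)

/-- The Laplacian `Δu = Σᵢ ∂²u/∂xᵢ²` on `ℝ²`. -/
def lapR2 (u : R2 → ℝ) (x : R2) : ℝ :=
  ∑ i : Fin 2,
    fderiv ℝ (fun y => fderiv ℝ u y (EuclideanSpace.single i 1)) x (EuclideanSpace.single i 1)

/-- `u` is a classical `C²` solution of `−Δu = R e^u` on `ℝ²`. -/
def IsSolution (R u : R2 → ℝ) : Prop :=
  ContDiff ℝ 2 u ∧ ∀ x, -lapR2 u x = R x * Real.exp (u x)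

/-- The asymptotic behaviour `u(x) = −η log |x| + O(1)` as `|x| → ∞`. -/
def AsympLog (η : ℝ) (u : R2 → ℝ) : Prop :=
  ∃ C : ℝ, ∀ x : R2, 1 ≤ ‖x‖ → |u x + η * Real.log ‖x‖| ≤ C

/-- `lim_{|x|→∞} R(x) |x|^{4−η}` exists and lies in `(0, +∞)`. -/
def LimInfty (R : R2 → ℝ) (η : ℝ) : Prop :=
  ∃ L : ℝ, 0 < L ∧
    Tendsto (fun x : R2 => R x * ‖x‖ ^ (4 - η)) (Bornology.cobounded R2) (𝓝 L)

/-- The positivity region `R⁺`. -/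
def Rplus (R : R2 → ℝ) : Set R2 := {x | 0 < R x}

/-- The negativity region `R⁻`. -/
def Rminus (R : R2 → ℝ) : Set R2 := {x | R x < 0}

/-- The nodal set `R⁰`. -/
def Rzero (R : R2 → ℝ) : Set R2 := {x | R x = 0}

/-- Regularity hypothesis (reg): `R ∈ C⁰(ℝ²) ∩ C^{2,a}(U)` and `∇R ≠ 0` on
`cl(R⁺) ∩ cl(R⁻)`, where `U` is a neighbourhood of `cl(R⁺) ∩ cl(R⁻)`. -/
def RegHyp (R : R2 → ℝ) (U : Set R2) (a : NNReal) : Prop :=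
  Continuous R ∧ IsOpen U ∧ closure (Rplus R) ∩ closure (Rminus R) ⊆ U ∧
    ContDiffOn ℝ 2 R U ∧ (∃ C : NNReal, HolderOnWith C a (iteratedFDeriv ℝ 2 R) U) ∧
    ∀ x ∈ closure (Rplus R) ∩ closure (Rminus R), gradient R x ≠ 0

/-- The decomposition `R⁰ = (cl R⁺ ∩ cl R⁻) ⊔ 𝒬⁺ ⊔ 𝒬⁻`, where `𝒬^±` are the (possibly
empty) parts of the nodal set surrounded by the positive/negative nodal regions of `R`. -/
def QSpec (R : R2 → ℝ) (Qp Qm : Set R2) : Prop :=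
  Rzero R = (closure (Rplus R) ∩ closure (Rminus R)) ∪ Qp ∪ Qm ∧
    Disjoint Qp Qm ∧
    Disjoint (closure (Rplus R) ∩ closure (Rminus R)) Qp ∧
    Disjoint (closure (Rplus R) ∩ closure (Rminus R)) Qm ∧
    frontier Qp ⊆ closure (Rplus R) \ closure (Rminus R) ∧
    frontier Qm ⊆ closure (Rminus R) \ closure (Rplus R)

/-- Distance between two subsets of the plane (valued in `[0, ∞]`). -/
def esetDist (A B : Set R2) : ENNReal := ⨅ x ∈ A, EMetric.infEdist x B

/-- `r = (1/3) min { dist(𝒬⁺, cl R⁻), dist(𝒬⁻, cl R⁺) } > 0`. -/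
def rSpec (R : R2 → ℝ) (Qp Qm : Set R2) (r : ℝ) : Prop :=
  0 < r ∧ r = (1 / 3) *
    (min (esetDist Qp (closure (Rminus R))) (esetDist Qm (closure (Rplus R)))).toReal


theorem second_deriv_max (g h : ℝ → ℝ) (c : ℝ) (hg : ∀ s, HasDerivAt g (h s) s)
    (hh : HasDerivAt h c 0) (hm : IsLocalMax g 0) : c ≤ 0 := by
  by_contra hc
  push Not at hc
  have hd : deriv g = h := funext fun s => (hg s).deriv
  have hmin : IsLocalMin g 0 := by
    apply isLocalMin_of_deriv_deriv_pos
    · rw [hd, hh.deriv]; exact hc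
    · exact hm.deriv_eq_zero
    · exact (hg 0).continuousAt
  have he : g =ᶠ[𝓝 0] fun _ => g 0 := by
    filter_upwards [hm, hmin] with s h1 h2
    exact le_antisymm h1 h2
  have h2 : deriv g =ᶠ[𝓝 0] deriv (fun _ : ℝ => g 0) := he.deriv
  have h3 := h2.deriv_eq
  rw [hd, hh.deriv] at h3
  simp at h3
  exact hc.ne' h3

theorem lap_at_max (u : R2 → ℝ) (hu : ContDiff ℝ 2 u) (t : ℝ) (x : R2)
    (hm : IsLocalMax (fun y => u y + t * ‖y‖ ^ 2) x) : lapR2 u x ≤ -(4 * t) := by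
  have key : ∀ i : Fin 2, fderiv ℝ (fun y => fderiv ℝ u y (EuclideanSpace.single i 1)) x
      (EuclideanSpace.single i 1) + t * 2 ≤ 0 := by
    intro i
    set e : R2 := EuclideanSpace.single i 1 with he
    have hne : inner ℝ e e = (1 : ℝ) := by simp [he]
    have hline : ∀ s : ℝ, HasDerivAt (fun s : ℝ => x + s • e) e s := by
      intro s
      simpa using ((hasDerivAt_id s).smul_const e).const_add x
    have hud : Differentiable ℝ u := hu.differentiable (by norm_num)
    have hfd : Differentiable ℝ (fun y => fderiv ℝ u y e) := by
      have : ContDiff ℝ 1 (fderiv ℝ u) := hu.fderiv_right (by norm_num)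
      exact (this.differentiable (by norm_num)).clm_apply (differentiable_const e)
    have hq : (fun s : ℝ => ‖x + s • e‖ ^ 2) =
        fun s => ‖x‖ ^ 2 + 2 * (s * inner ℝ x e) + s ^ 2 := by
      funext s
      rw [norm_add_sq_real, real_inner_smul_right, ← real_inner_self_eq_norm_sq (s • e),
        real_inner_smul_left, real_inner_smul_right, hne]
      ring
    have h0 : x + (0 : ℝ) • e = x := by simp
    apply second_deriv_max (fun s => u (x + s • e) + t * ‖x + s • e‖ ^ 2)
      (fun s => fderiv ℝ u (x + s • e) e + t * (2 * inner ℝ x e + 2 * s))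
    · intro s
      refine HasDerivAt.add ?_ (HasDerivAt.const_mul t ?_)
      · exact (hud (x + s • e)).hasFDerivAt.comp_hasDerivAt s (hline s)
      · rw [hq]
        have h1 := ((((hasDerivAt_id s).mul_const (inner ℝ x e)).const_mul 2).const_add
          (‖x‖ ^ 2)).add ((hasDerivAt_id s).pow 2)
        refine (h1.congr_deriv ?_)
        simp
    · refine HasDerivAt.add ?_ (HasDerivAt.const_mul t ?_)
      · have h1 := (hfd (x + (0 : ℝ) • e)).hasFDerivAt.comp_hasDerivAt 0 (hline 0)
        rw [h0] at h1
        exact h1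
      · simpa using ((hasDerivAt_id (0 : ℝ)).const_mul 2).const_add (2 * inner ℝ x e)
    · have hc : Tendsto (fun s : ℝ => x + s • e) (𝓝 0) (𝓝 x) := by
        have := (hline 0).continuousAt.tendsto
        rwa [h0] at this
      have := hc.eventually hm
      filter_upwards [this] with s hs
      simpa using hs
  have h0 := key 0
  have h1 := key 1
  unfold lapR2
  rw [Fin.sum_univ_two]
  linarith

theorem weak_max (u : R2 → ℝ) (hu : ContDiff ℝ 2 u) (N : Set R2) (hN : IsOpen N)
    (hcpt : IsCompact (closure N)) (C : ℝ) (hlap : ∀ x ∈ N, 0 ≤ lapR2 u x)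
    (hfr : ∀ x ∈ frontier N, u x ≤ C) : ∀ x ∈ N, u x ≤ C := by
  intro x0 hx0
  by_contra hlt
  push Not at hlt
  obtain ⟨M, hMpos, hM⟩ := hcpt.isBounded.exists_pos_norm_le
  set t := (u x0 - C) / (2 * M ^ 2) with ht
  have htpos : 0 < t := by
    have : 0 < u x0 - C := by linarith
    positivity
  have htM : t * M ^ 2 = (u x0 - C) / 2 := by rw [ht]; field_simp
  have hcont : Continuous (fun y : R2 => u y + t * ‖y‖ ^ 2) := by
    have := hu.continuous
    fun_prop
  obtain ⟨x1, hx1, hmax⟩ := hcpt.exists_isMaxOn ⟨x0, subset_closure hx0⟩ hcont.continuousOn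
  have h01 : u x0 + t * ‖x0‖ ^ 2 ≤ u x1 + t * ‖x1‖ ^ 2 := hmax (subset_closure hx0)
  have h0 : 0 ≤ t * ‖x0‖ ^ 2 := by positivity
  have h1 : t * ‖x1‖ ^ 2 ≤ t * M ^ 2 := by
    have := hM x1 hx1
    gcongr
  have hx1N : x1 ∈ N := by
    by_contra hn
    have : x1 ∈ frontier N := by
      rw [hN.frontier_eq]; exact ⟨hx1, hn⟩
    have := hfr x1 this
    linarith
  have hloc : IsLocalMax (fun y => u y + t * ‖y‖ ^ 2) x1 := by
    filter_upwards [hN.mem_nhds hx1N] with y hy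
    exact hmax (subset_closure hy)
  have := lap_at_max u hu t x1 hloc
  have := hlap x1 hx1N
  linarith

/-- **Lemma 2.11.**  Under the hypotheses of Proposition 2.8, if a solution `u` of
`−Δu = R e^u` with `u = −η log|x| + O(1)` satisfies `u ≤ C` on `{R ≤ ε} \ (𝒬)^r` for
constants `ε, C > 0` as produced by the a priori estimate away from `𝒬`, then also
`u(x) ≤ C` for every `x ∈ (𝒬⁻)^r`. -/
theorem statement9 (R : R2 → ℝ) (U : Set R2) (a : NNReal) (ha : 0 < a) (ha1 : a ≤ 1)
    (hreg : RegHyp R U a) (η : ℝ) (hη : 4 < η) (hlim : LimInfty R η)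
    (Qp Qm : Set R2) (hQ : QSpec R Qp Qm) (r : ℝ) (hr : rSpec R Qp Qm r)
    (β δ : ℝ) (hβ : 0 < β) (hδ : 0 < δ)
    (hgrad : ∀ x, |R x| ≤ δ → x ∉ thickening r (Qp ∪ Qm) → β ≤ ‖gradient R x‖)
    (ε C : ℝ) (hε : 0 < ε) (hC : 0 < C)
    (u : R2 → ℝ) (hu : IsSolution R u) (hasymp : AsympLog η u)
    (hbound : ∀ x : R2, R x ≤ ε → x ∉ thickening r (Qp ∪ Qm) → u x ≤ C) :
    ∀ x ∈ thickening r Qm, u x ≤ C := by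
  obtain ⟨hrpos, hreq⟩ := hr
  obtain ⟨hQeq, hQd, hdp, hdm, hfp, hfm⟩ := hQ
  have hRc : Continuous R := hreg.1
  set m := min (esetDist Qp (closure (Rminus R))) (esetDist Qm (closure (Rplus R))) with hm
  have hmr : m.toReal = 3 * r := by linarith
  have hmtop : m ≠ ⊤ := by
    intro h
    rw [h] at hmr
    simp at hmr
    linarith
  have hmle : m = ENNReal.ofReal (3 * r) := by rw [← hmr, ENNReal.ofReal_toReal hmtop]
  have hp : ∀ q ∈ Qp, ∀ z ∈ closure (Rminus R), 3 * r ≤ dist q z := by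
    intro q hq z hz
    have h1 : m ≤ edist q z :=
      ((min_le_left _ _).trans (iInf₂_le q hq)).trans (Metric.infEDist_le_edist_of_mem hz)
    rw [hmle, edist_dist] at h1
    exact (ENNReal.ofReal_le_ofReal_iff dist_nonneg).1 h1
  have hmm : ∀ q ∈ Qm, ∀ z ∈ closure (Rplus R), 3 * r ≤ dist q z := by
    intro q hq z hz
    have h1 : m ≤ edist q z :=
      ((min_le_right _ _).trans (iInf₂_le q hq)).trans (Metric.infEDist_le_edist_of_mem hz)
    rw [hmle, edist_dist] at h1
    exact (ENNReal.ofReal_le_ofReal_iff dist_nonneg).1 h1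
  -- points near Qm
  have hneg : ∀ x ∈ thickening (2 * r) Qm, R x ≤ 0 := by
    intro x hx
    by_contra hpos
    push Not at hpos
    obtain ⟨z, hz, hxz⟩ := mem_thickening_iff.1 hx
    have := hmm z hz x (subset_closure hpos)
    rw [dist_comm] at this
    linarith
  have hbdd : Bornology.IsBounded {x | R x ≤ 0} := by
    obtain ⟨L, hL, hT⟩ := hlim
    have h1 := hT.eventually (lt_mem_nhds hL)
    rw [← Bornology.isCobounded_compl_iff]
    refine Filter.mem_of_superset h1 ?_
    intro x hx
    simp only [Set.mem_compl_iff, Set.mem_setOf_eq, not_le]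
    simp only [Set.mem_setOf_eq] at hx
    by_contra hn
    push Not at hn
    have : R x * ‖x‖ ^ (4 - η) ≤ 0 :=
      mul_nonpos_of_nonpos_of_nonneg hn (Real.rpow_nonneg (norm_nonneg _) _)
    linarith
  have hcl : closure (thickening r Qm) ⊆ thickening (2 * r) Qm :=
    (closure_thickening_subset_cthickening r Qm).trans
      (cthickening_subset_thickening' (by linarith) (by linarith) Qm)
  have hsub : closure (thickening r Qm) ⊆ {x | R x ≤ 0} := fun x hx => hneg x (hcl hx)
  have hcpt : IsCompact (closure (thickening r Qm)) :=
    Metric.isCompact_of_isClosed_isBounded isClosed_closure (hbdd.subset hsub)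
  refine weak_max u hu.1 _ isOpen_thickening hcpt C ?_ ?_
  · intro x hx
    have h1 := hu.2 x
    have h2 : R x * Real.exp (u x) ≤ 0 :=
      mul_nonpos_of_nonpos_of_nonneg (hsub (subset_closure hx)) (Real.exp_pos _).le
    linarith
  · intro x hx
    have hxcl := frontier_subset_closure hx
    have hxn : x ∉ thickening r Qm := by
      rw [isOpen_thickening.frontier_eq] at hx; exact hx.2
    refine hbound x ((hsub hxcl).trans hε.le) ?_
    rw [thickening_union]
    rintro (hxp | hxm)
    · obtain ⟨q, hq, hxq⟩ := mem_thickening_iff.1 hxp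
      obtain ⟨p, hpm, hxp'⟩ := mem_thickening_iff.1 (hcl hxcl)
      have hqm : q ∉ Qm := by
        intro h
        exact Set.disjoint_left.1 hQd hq h
      have hne : (segment ℝ q p ∩ frontier Qm).Nonempty := by
        have hpre : IsPreconnected (segment ℝ q p) := (convex_segment q p).isPreconnected
        by_contra hemp
        have hno : ∀ y ∈ segment ℝ q p, y ∈ closure Qm → y ∈ interior Qm := by
          intro y hy hyc
          by_contra hyi
          exact hemp ⟨y, hy, hyc, hyi⟩
        have hps := right_mem_segment ℝ q p
        have hqs := left_mem_segment ℝ q p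
        obtain ⟨y, -, hy1, hy2⟩ := hpre (interior Qm) (closure Qm)ᶜ isOpen_interior
          isClosed_closure.isOpen_compl
          (fun y hy => by
            by_cases h : y ∈ closure Qm
            · exact Or.inl (hno y hy h)
            · exact Or.inr h)
          ⟨p, hps, hno p hps (subset_closure hpm)⟩
          ⟨q, hqs, fun h => hqm (interior_subset (hno q hqs h))⟩
        exact hy2 (subset_closure (interior_subset hy1))
      obtain ⟨z, hzs, hzf⟩ := hne
      have h1 := hp q hq z (hfm hzf).1
      have h2 : dist q z ≤ dist q p := by
        have := dist_add_dist_of_mem_segment hzs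
        have := dist_nonneg (x := z) (y := p)
        linarith
      have h3 := dist_triangle q x p
      rw [dist_comm q x] at h3
      linarith
    · exact hxn hxm

end
end

section
/- Let R : ℝ² → ℝ be a bounded, continuous, radially symmetric function for which there exists r₀ > 0 such that R is positive and non-increasing on {|x| < r₀} and negative on {|x| > r₀}. Then for every η ≥ 4 there is no solution u of −Δu = R e^u on ℝ² satisfying u(x) = −η log|x| + O(1) as |x| → ∞. -/
open MeasureTheory Real Topology Filter Metric

noncomputable section

lemma second_deriv_nonneg (g g' : ℝ → ℝ) (c t₀ : ℝ) (hg : ∀ t, HasDerivAt g (g' t) t)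
    (hg' : HasDerivAt g' c t₀) (hmin : IsLocalMin g t₀) : 0 ≤ c := by
  by_contra hcneg
  push Not at hcneg
  have hd : deriv g = g' := funext fun t => (hg t).deriv
  have hmax : IsLocalMax g t₀ := by
    apply isLocalMax_of_deriv_deriv_neg
    · rw [hd, hg'.deriv]; exact hcneg
    · exact hmin.deriv_eq_zero
    · exact (hg t₀).continuousAt
  have heq : g =ᶠ[𝓝 t₀] fun _ => g t₀ := by
    filter_upwards [hmin, hmax] with t h1 h2
    exact le_antisymm h2 h1
  have h2 : g' =ᶠ[𝓝 t₀] fun _ => 0 := by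
    have := heq.deriv
    rw [hd] at this
    simpa using this
  have h3 := h2.deriv_eq
  rw [hg'.deriv] at h3
  simp at h3
  linarith

lemma exists_min_strip (G : ℝ → ℝ → ℝ) (hc : Continuous (fun p : ℝ × ℝ => G p.1 p.2))
    (hp : ∀ t s, G t (s + 2 * π) = G t s) (a b : ℝ) (hab : a ≤ b) :
    ∃ t₀ ∈ Set.Icc a b, ∃ s₀, ∀ t ∈ Set.Icc a b, ∀ s, G t₀ s₀ ≤ G t s := by
  have hK : IsCompact (Set.Icc a b ×ˢ Set.Icc (0:ℝ) (2 * π)) := isCompact_Icc.prod isCompact_Icc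
  have hne : (Set.Icc a b ×ˢ Set.Icc (0:ℝ) (2 * π)).Nonempty :=
    ⟨(a, 0), ⟨⟨le_rfl, hab⟩, ⟨le_rfl, by positivity⟩⟩⟩
  obtain ⟨⟨t₀, s₀⟩, hm, hmin⟩ := hK.exists_isMinOn hne hc.continuousOn
  refine ⟨t₀, hm.1, s₀, fun t ht s => ?_⟩
  have hper : Function.Periodic (G t) (2 * π) := hp t
  obtain ⟨y, hy, hys⟩ := hper.exists_mem_Ico₀ (by positivity) s
  rw [hys]
  exact hmin (show (t, y) ∈ _ from ⟨ht, ⟨hy.1, hy.2.le⟩⟩)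

lemma mp_strip (G Gt Gtt Gs Gss : ℝ → ℝ → ℝ)
    (hc : Continuous (fun p : ℝ × ℝ => G p.1 p.2))
    (hp : ∀ t s, G t (s + 2 * π) = G t s)
    (h1 : ∀ t s, HasDerivAt (fun t => G t s) (Gt t s) t)
    (h2 : ∀ t s, HasDerivAt (fun t => Gt t s) (Gtt t s) t)
    (h3 : ∀ t s, HasDerivAt (fun s => G t s) (Gs t s) s)
    (h4 : ∀ t s, HasDerivAt (fun s => Gs t s) (Gss t s) s)
    (a b : ℝ) (ha : ∀ s, 0 ≤ G a s) (hb : ∀ s, 0 ≤ G b s)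
    (hlap : ∀ t s, a < t → t < b → G t s < 0 → Gtt t s + Gss t s < 0) :
    ∀ t ∈ Set.Icc a b, ∀ s, 0 ≤ G t s := by
  intro t ht s
  obtain ⟨t₀, ht₀, s₀, hmin⟩ := exists_min_strip G hc hp a b (ht.1.trans ht.2)
  refine le_trans ?_ (hmin t ht s)
  by_contra hneg
  push Not at hneg
  have hat : a < t₀ := lt_of_le_of_ne ht₀.1 (fun h => by subst h; linarith [ha s₀])
  have htb : t₀ < b := lt_of_le_of_ne ht₀.2 (fun h => by subst h; linarith [hb s₀])
  have e1 : 0 ≤ Gtt t₀ s₀ := by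
    refine second_deriv_nonneg (fun t => G t s₀) (fun t => Gt t s₀) _ t₀ (fun t => h1 t s₀)
      (h2 t₀ s₀) ?_
    filter_upwards [Ioo_mem_nhds hat htb] with t ht
    exact hmin t ⟨ht.1.le, ht.2.le⟩ s₀
  have e2 : 0 ≤ Gss t₀ s₀ := by
    refine second_deriv_nonneg (fun s => G t₀ s) (fun s => Gs t₀ s) _ s₀ (fun s => h3 t₀ s)
      (h4 t₀ s₀) ?_
    exact Filter.Eventually.of_forall fun s => hmin t₀ ht₀ s
  linarith [hlap t₀ s₀ hat htb hneg]

/-- Phragmén–Lindelöf on a half cylinder. -/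
lemma pl_half (G Gt Gtt Gs Gss : ℝ → ℝ → ℝ)
    (hc : Continuous (fun p : ℝ × ℝ => G p.1 p.2))
    (hp : ∀ t s, G t (s + 2 * π) = G t s)
    (h1 : ∀ t s, HasDerivAt (fun t => G t s) (Gt t s) t)
    (h2 : ∀ t s, HasDerivAt (fun t => Gt t s) (Gtt t s) t)
    (h3 : ∀ t s, HasDerivAt (fun s => G t s) (Gs t s) s)
    (h4 : ∀ t s, HasDerivAt (fun s => Gs t s) (Gss t s) s)
    (a : ℝ) (ha : ∀ s, 0 ≤ G a s) (C : ℝ) (hC : ∀ t ≤ a, ∀ s, C ≤ G t s)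
    (hlap : ∀ t s, t < a → Gtt t s + Gss t s < 0) :
    ∀ t ≤ a, ∀ s, 0 ≤ G t s := by
  intro t ht s
  have key : ∀ ε > 0, 0 ≤ G t s + ε * (a - t) := by
    intro ε hε
    set b := min t (a - |C| / ε) with hb
    have hbt : b ≤ t := min_le_left _ _
    have hba : b ≤ a - |C| / ε := min_le_right _ _
    refine mp_strip (fun t s => G t s + ε * (a - t)) (fun t s => Gt t s - ε) Gtt Gs Gss
      (hc.add (by fun_prop)) (fun t s => by simp only [hp]) ?_ ?_ ?_ h4 b a ?_ ?_ ?_ t ⟨hbt, ht⟩ s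
    · intro t s
      exact ((h1 t s).add ((((hasDerivAt_id t).const_sub a).const_mul ε))).congr_deriv (by ring)
    · intro t s
      exact (h2 t s).sub_const ε
    · intro t s
      exact (h3 t s).add_const _
    · intro s
      have h5 := hC b (hbt.trans ht) s
      have h6 : |C| / ε ≤ a - b := by linarith
      rw [div_le_iff₀ hε] at h6
      have := neg_abs_le C
      show 0 ≤ G b s + ε * (a - b)
      nlinarith
    · intro s
      show 0 ≤ G a s + ε * (a - a)
      simpa using ha s
    · intro t s _ hta _
      exact hlap t s hta
  by_contra hneg
  push Not at hneg
  have hat : 0 ≤ a - t := by linarith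
  have := key (-G t s / (2 * (a - t + 1))) (by apply div_pos <;> linarith)
  have h7 : -G t s / (2 * (a - t + 1)) * (a - t) ≤ -G t s / 2 := by
    rw [div_mul_eq_mul_div, div_le_div_iff₀ (by linarith) (by norm_num)]
    nlinarith
  linarith

lemma core (U Ut Utt Us Uss : ℝ → ℝ → ℝ) (K : ℝ → ℝ) (T C : ℝ)
    (hc : Continuous (fun p : ℝ × ℝ => U p.1 p.2))
    (hct : Continuous (fun p : ℝ × ℝ => Ut p.1 p.2))
    (hp : ∀ t s, U t (s + 2 * π) = U t s)
    (hpt : ∀ t s, Ut t (s + 2 * π) = Ut t s)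
    (h1 : ∀ t s, HasDerivAt (fun t => U t s) (Ut t s) t)
    (h2 : ∀ t s, HasDerivAt (fun t => Ut t s) (Utt t s) t)
    (h3 : ∀ t s, HasDerivAt (fun s => U t s) (Us t s) s)
    (h4 : ∀ t s, HasDerivAt (fun s => Us t s) (Uss t s) s)
    (hpde : ∀ t s, Utt t s + Uss t s = -(K t * Real.exp (U t s)))
    (hK1 : ∀ t < T, 0 < K t) (hK2 : ∀ t, T ≤ t → K t ≤ 0)
    (hK3 : ∀ s t, s ≤ t → t < T → K t ≤ K s)
    (hb1 : ∀ t s, U t s ≤ C - 2 * t)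
    (hb2 : ∀ a, ∃ D, ∀ t ≤ a, ∀ s, 2 * t - D ≤ U t s)
    (hinc : ∃ N, ∀ t ≤ N, ∀ s, 0 < Ut t s) : False := by
  -- the reflected difference
  have W1 : ∀ τ t s, HasDerivAt (fun t => U t s - U (2 * τ - t) s)
      (Ut t s + Ut (2 * τ - t) s) t := by
    intro τ t s
    have hr : HasDerivAt (fun t : ℝ => 2 * τ - t) (-1) t := (hasDerivAt_id t).const_sub _
    exact ((h1 t s).sub ((h1 (2 * τ - t) s).comp t hr)).congr_deriv (by ring)
  have W2 : ∀ τ t s, HasDerivAt (fun t => Ut t s + Ut (2 * τ - t) s)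
      (Utt t s - Utt (2 * τ - t) s) t := by
    intro τ t s
    have hr : HasDerivAt (fun t : ℝ => 2 * τ - t) (-1) t := (hasDerivAt_id t).const_sub _
    exact ((h2 t s).add ((h2 (2 * τ - t) s).comp t hr)).congr_deriv (by ring)
  have W3 : ∀ τ t s, HasDerivAt (fun s => U t s - U (2 * τ - t) s)
      (Us t s - Us (2 * τ - t) s) s := fun τ t s => (h3 t s).sub (h3 _ s)
  have W4 : ∀ τ t s, HasDerivAt (fun s => Us t s - Us (2 * τ - t) s)
      (Uss t s - Uss (2 * τ - t) s) s := fun τ t s => (h4 t s).sub (h4 _ s)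
  have Wc3 : Continuous (fun q : ℝ × ℝ × ℝ => U q.2.1 q.2.2 - U (2 * q.1 - q.2.1) q.2.2) :=
    (hc.comp (by fun_prop : Continuous fun q : ℝ × ℝ × ℝ => (q.2.1, q.2.2))).sub
      (hc.comp (by fun_prop : Continuous fun q : ℝ × ℝ × ℝ => (2 * q.1 - q.2.1, q.2.2)))
  have Wc : ∀ τ, Continuous (fun p : ℝ × ℝ => U p.1 p.2 - U (2 * τ - p.1) p.2) := fun τ =>
    Wc3.comp (by fun_prop : Continuous fun p : ℝ × ℝ => (τ, p.1, p.2))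
  have Wp : ∀ τ t s, U t (s + 2 * π) - U (2 * τ - t) (s + 2 * π) = U t s - U (2 * τ - t) s := by
    intro τ t s; rw [hp, hp]
  have Wlap : ∀ τ t s, t < T → T ≤ 2 * τ - t →
      (Utt t s - Utt (2 * τ - t) s) + (Uss t s - Uss (2 * τ - t) s) < 0 := by
    intro τ t s ht ht'
    have e1 := hpde t s
    have e2 := hpde (2 * τ - t) s
    have e3 : 0 < K t * Real.exp (U t s) := mul_pos (hK1 t ht) (Real.exp_pos _)
    have e4 : K (2 * τ - t) * Real.exp (U (2 * τ - t) s) ≤ 0 :=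
      mul_nonpos_of_nonpos_of_nonneg (hK2 _ ht') (Real.exp_pos _).le
    linarith
  have Wlap' : ∀ τ t s, t < τ → τ ≤ T → 0 ≤ U t s - U (2 * τ - t) s →
      (Utt t s - Utt (2 * τ - t) s) + (Uss t s - Uss (2 * τ - t) s) ≤ 0 := by
    intro τ t s ht hτ hW
    rcases le_or_gt T (2 * τ - t) with h | h
    · exact (Wlap τ t s (by linarith) h).le
    · have e1 := hpde t s
      have e2 := hpde (2 * τ - t) s
      have e3 : K (2 * τ - t) ≤ K t := hK3 _ _ (by linarith) h
      have e4 : 0 < K (2 * τ - t) := hK1 _ h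
      have e5 : Real.exp (U (2 * τ - t) s) ≤ Real.exp (U t s) :=
        Real.exp_le_exp.2 (by linarith)
      have := mul_le_mul e3 e5 (Real.exp_pos _).le (by linarith)
      linarith
  have Wlow : ∀ τ a, ∃ D, ∀ t ≤ a, ∀ s, D ≤ U t s - U (2 * τ - t) s := by
    intro τ a
    obtain ⟨D, hD⟩ := hb2 a
    refine ⟨4 * τ - D - C, fun t ht s => ?_⟩
    have := hD t ht s
    have := hb1 (2 * τ - t) s
    linarith
  have Wpl : ∀ τ a, a ≤ T → a ≤ 2 * τ - T → (∀ s, 0 ≤ U a s - U (2 * τ - a) s) →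
      ∀ t ≤ a, ∀ s, 0 ≤ U t s - U (2 * τ - t) s := by
    intro τ a haT ha h
    obtain ⟨D, hD⟩ := Wlow τ a
    exact pl_half (fun t s => U t s - U (2 * τ - t) s) _ _ _ _ (Wc τ) (Wp τ) (W1 τ) (W2 τ) (W3 τ)
      (W4 τ) a h D hD (fun t s ht => Wlap τ t s (by linarith) (by linarith))
  let S : Set ℝ := {τ | τ ≤ T ∧ ∀ t ≤ τ, ∀ s, 0 ≤ U t s - U (2 * τ - t) s}
  have hTS : T ∈ S := by
    refine ⟨le_rfl, Wpl T T le_rfl (by linarith) (fun s => ?_)⟩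
    rw [show 2 * T - T = T by ring, sub_self]
  have hSb : BddBelow S := by
    obtain ⟨N, hN⟩ := hinc
    refine ⟨N - 1, fun τ hτ => ?_⟩
    by_contra hlt
    push Not at hlt
    have hm : StrictMonoOn (fun t => U t 0) (Set.Iic N) := by
      apply strictMonoOn_of_deriv_pos (convex_Iic N)
      · exact fun t _ => (h1 t 0).continuousAt.continuousWithinAt
      · intro t ht
        rw [interior_Iic] at ht
        rw [(h1 t 0).deriv]
        exact hN t (le_of_lt ht) 0
    have e1 := hτ.2 (τ - 1) (by linarith) 0
    have e2 : U (τ - 1) 0 < U (2 * τ - (τ - 1)) 0 :=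
      hm (show τ - 1 ≤ N by linarith) (show 2 * τ - (τ - 1) ≤ N by linarith) (by linarith)
    linarith
  have hScl : IsClosed S := by
    rw [← isSeqClosed_iff_isClosed]
    intro x τ hx hlim
    refine ⟨le_of_tendsto' hlim fun n => (hx n).1, ?_⟩
    have hlt : ∀ t < τ, ∀ s, 0 ≤ U t s - U (2 * τ - t) s := by
      intro t ht s
      have hcont : Continuous fun σ : ℝ => U t s - U (2 * σ - t) s :=
        Wc3.comp (by fun_prop : Continuous fun σ : ℝ => (σ, t, s))
      refine ge_of_tendsto ((hcont.tendsto τ).comp hlim) ?_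
      filter_upwards [hlim.eventually (lt_mem_nhds ht)] with n hn
      exact (hx n).2 t hn.le s
    intro t ht s
    rcases lt_or_eq_of_le ht with h | h
    · exact hlt t h s
    · subst h
      rw [show 2 * t - t = t by ring, sub_self]
  obtain ⟨hτT, hτ⟩ := hScl.csInf_mem ⟨T, hTS⟩ hSb
  set τ := sInf S with hτdef
  -- strict positivity far to the left
  set a := 2 * τ - T - 1 with ha
  have hapos : ∀ s, 0 < U a s - U (2 * τ - a) s := by
    intro s
    refine lt_of_le_of_ne (hτ a (by linarith) s) (fun h0 => ?_)
    have e1 := second_deriv_nonneg _ _ _ a (fun t => W1 τ t s) (W2 τ a s) (by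
      filter_upwards [gt_mem_nhds (show a < τ by linarith)] with t ht
      rw [← h0]; exact hτ t (le_of_lt ht) s)
    have e2 := second_deriv_nonneg _ _ _ s (fun s => W3 τ a s) (W4 τ a s) (by
      refine Filter.Eventually.of_forall fun s' => ?_
      show U a s - U (2 * τ - a) s ≤ _
      rw [← h0]; exact hτ a (by linarith) s')
    have := Wlap τ a s (by linarith) (by linarith)
    linarith
  obtain ⟨t₁, ht₁, s₁, hmin⟩ := exists_min_strip (fun t s => U t s - U (2 * τ - t) s) (Wc τ)
    (Wp τ) a a le_rfl
  have ht₁a : t₁ = a := le_antisymm ht₁.2 ht₁.1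
  subst ht₁a
  set c := U a s₁ - U (2 * τ - a) s₁ with hcdef
  have hcpos : 0 < c := hapos s₁
  have hcmin : ∀ s, c ≤ U a s - U (2 * τ - a) s := fun s => hmin a ⟨le_rfl, le_rfl⟩ s
  have haτ : 0 < τ - a := by linarith
  -- barrier
  obtain ⟨ε, hε, hεc⟩ : ∃ ε > 0, ε * ((τ - a) + (τ - a) ^ 2) ≤ c := by
    have hq : 0 < (τ - a) + (τ - a) ^ 2 := by positivity
    exact ⟨c / ((τ - a) + (τ - a) ^ 2), div_pos hcpos hq, by rw [div_mul_cancel₀ _ hq.ne']⟩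
  have hbar : ∀ t ∈ Set.Icc a τ, ∀ s,
      0 ≤ (U t s - U (2 * τ - t) s) - ε * ((τ - t) + (τ - t) ^ 2) := by
    refine mp_strip (fun t s => (U t s - U (2 * τ - t) s) - ε * ((τ - t) + (τ - t) ^ 2))
      (fun t s => (Ut t s + Ut (2 * τ - t) s) - ε * (-1 - 2 * (τ - t)))
      (fun t s => (Utt t s - Utt (2 * τ - t) s) - ε * 2)
      (fun t s => Us t s - Us (2 * τ - t) s) (fun t s => Uss t s - Uss (2 * τ - t) s)
      ((Wc τ).sub (by fun_prop)) (fun t s => by simp only [Wp]) ?_ ?_ ?_ (W4 τ) a τ ?_ ?_ ?_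
    · intro t s
      have hr : HasDerivAt (fun t : ℝ => τ - t) (-1) t := (hasDerivAt_id t).const_sub _
      refine (W1 τ t s).sub (HasDerivAt.const_mul ε ?_)
      exact (hr.add (hr.pow 2)).congr_deriv (by norm_num; ring)
    · intro t s
      have hr : HasDerivAt (fun t : ℝ => τ - t) (-1) t := (hasDerivAt_id t).const_sub _
      refine (W2 τ t s).sub (HasDerivAt.const_mul ε ?_)
      exact ((hr.const_mul 2).const_sub (-1)).congr_deriv (by ring)
    · intro t s
      exact (W3 τ t s).sub_const _
    · intro s
      have := hcmin s
      show 0 ≤ (U a s - U (2 * τ - a) s) - ε * ((τ - a) + (τ - a) ^ 2)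
      linarith
    · intro s
      show 0 ≤ (U τ s - U (2 * τ - τ) s) - ε * ((τ - τ) + (τ - τ) ^ 2)
      rw [show 2 * τ - τ = τ by ring]; simp
    · intro t s _ htτ _
      have := Wlap' τ t s htτ hτT (hτ t htτ.le s)
      show (Utt t s - Utt (2 * τ - t) s) - ε * 2 + (Uss t s - Uss (2 * τ - t) s) < 0
      linarith
  have hUtneg : ∀ s, Ut τ s < 0 := by
    intro s
    have hr : HasDerivAt (fun t : ℝ => ε * (τ - t)) (ε * (-1)) τ :=
      ((hasDerivAt_id τ).const_sub _).const_mul ε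
    have hd := (W1 τ τ s).sub hr
    have hle : (Ut τ s + Ut (2 * τ - τ) s) - ε * (-1) ≤ 0 := by
      by_contra hpos
      push Not at hpos
      have hd' := hd.hasDerivWithinAt (s := Set.Iio τ)
      rw [hasDerivWithinAt_iff_tendsto_slope' (by simp)] at hd'
      have := (hd'.eventually (lt_mem_nhds hpos)).and
        (Ioo_mem_nhdsLT (show a < τ by linarith))
      obtain ⟨t, h5, h6⟩ := this.exists
      rw [slope_def_field] at h5
      have h7 := hbar t ⟨h6.1.le, h6.2.le⟩ s
      have h8 : t - τ < 0 := by linarith [h6.2]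
      have h9 : ¬ (0 < (t - τ)⁻¹) := by
        rw [inv_pos]; linarith
      simp only [Pi.sub_apply, show 2 * τ - τ = τ by ring, sub_self, mul_zero, sub_zero] at h5
      have h10 : (U t s - U (2 * τ - t) s - ε * (τ - t)) / (t - τ) ≤ 0 :=
        div_nonpos_of_nonneg_of_nonpos (by nlinarith [sq_nonneg (τ - t)]) h8.le
      linarith
    rw [show 2 * τ - τ = τ by ring] at hle
    linarith
  -- uniform negativity near τ
  have hev : ∀ᶠ t in 𝓝 τ, ∀ s ∈ Set.Icc (0:ℝ) (2 * π), Ut t s < 0 := by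
    apply isCompact_Icc.eventually_forall_of_forall_eventually
    intro s _
    exact hct.continuousAt.eventually (gt_mem_nhds (hUtneg s))
  obtain ⟨δ, hδ, hδt⟩ := Metric.eventually_nhds_iff.1 hev
  have hδneg : ∀ t, |t - τ| < δ → ∀ s, Ut t s < 0 := by
    intro t ht s
    have hper : Function.Periodic (Ut t) (2 * π) := hpt t
    obtain ⟨y, hy, hys⟩ := hper.exists_mem_Ico₀ (by positivity) s
    rw [hys]
    exact hδt (by rwa [Real.dist_eq]) y ⟨hy.1, hy.2.le⟩
  have hev2 : ∀ᶠ σ in 𝓝 τ, ∀ p ∈ Set.Icc a (τ - δ / 2) ×ˢ Set.Icc (0:ℝ) (2 * π),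
      0 < U p.1 p.2 - U (2 * σ - p.1) p.2 := by
    apply (isCompact_Icc.prod isCompact_Icc).eventually_forall_of_forall_eventually
    rintro ⟨t, s⟩ ⟨ht, _⟩
    have hpos : 0 < U t s - U (2 * τ - t) s := by
      have := hbar t ⟨ht.1, by linarith [ht.2]⟩ s
      have h8 : 0 < τ - t := by linarith [ht.2]
      have : 0 < ε * ((τ - t) + (τ - t) ^ 2) := by positivity
      linarith
    exact (Wc3.continuousAt (x := (τ, t, s))).eventually (lt_mem_nhds hpos)
  obtain ⟨δ', hδ', hδt'⟩ := Metric.eventually_nhds_iff.1 hev2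
  have hδpos : ∀ σ, |σ - τ| < δ' → ∀ t ∈ Set.Icc a (τ - δ / 2), ∀ s,
      0 < U t s - U (2 * σ - t) s := by
    intro σ hσ t ht s
    have hper : Function.Periodic (fun s => U t s - U (2 * σ - t) s) (2 * π) := Wp σ t
    obtain ⟨y, hy, hys⟩ := hper.exists_mem_Ico₀ (by positivity) s
    have hys' : U t s - U (2 * σ - t) s = U t y - U (2 * σ - t) y := hys
    rw [hys']
    exact hδt' (by rwa [Real.dist_eq]) (t, y) ⟨ht, hy.1, hy.2.le⟩
  -- the new plane
  set κ := min (min (δ / 4) (δ' / 2)) (1 / 2) with hκ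
  have hκ0 : 0 < κ := by positivity
  have k1 : κ ≤ δ / 4 := (min_le_left _ _).trans (min_le_left _ _)
  have k2 : κ ≤ δ' / 2 := (min_le_left _ _).trans (min_le_right _ _)
  have k3 : κ ≤ 1 / 2 := min_le_right _ _
  have hright : ∀ t ∈ Set.Icc a (τ - κ), ∀ s, 0 ≤ U t s - U (2 * (τ - κ) - t) s := by
    intro t ht s
    rcases le_or_gt t (τ - δ / 2) with h | h
    · exact (hδpos (τ - κ) (by rw [abs_lt]; constructor <;> linarith) t ⟨ht.1, h⟩ s).le
    · have hm : AntitoneOn (fun t => U t s) (Set.Icc (τ - δ / 2) (τ + δ / 2)) := by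
        apply antitoneOn_of_deriv_nonpos (convex_Icc _ _)
        · exact fun t _ => (h1 t s).continuousAt.continuousWithinAt
        · exact fun t _ => (h1 t s).differentiableAt.differentiableWithinAt
        · intro t ht
          rw [interior_Icc] at ht
          rw [(h1 t s).deriv]
          exact (hδneg t (by rw [abs_lt]; constructor <;> linarith [ht.1, ht.2]) s).le
      have := hm (a := t) (b := 2 * (τ - κ) - t) ⟨h.le, by linarith [ht.2]⟩
        ⟨by linarith [ht.2], by linarith⟩ (by linarith [ht.2])
      simp only at this
      linarith
  have hnew : τ - κ ∈ S := by
    refine ⟨by linarith, fun t ht s => ?_⟩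
    rcases le_or_gt a t with h | h
    · exact hright t ⟨h, ht⟩ s
    · exact Wpl (τ - κ) a (by linarith) (by linarith)
        (fun s => hright a ⟨le_rfl, by linarith⟩ s) t h.le s
  have := csInf_le hSb hnew
  linarith

lemma curve_deriv (h : R2 → ℝ) (hd : Differentiable ℝ h) (x y : ℝ → ℝ) (x' y' t : ℝ)
    (hx : HasDerivAt x x' t) (hy : HasDerivAt y y' t) :
    HasDerivAt (fun t => h !₂[x t, y t])
      (x' * fderiv ℝ h !₂[x t, y t] (EuclideanSpace.single 0 1)
        + y' * fderiv ℝ h !₂[x t, y t] (EuclideanSpace.single 1 1)) t := by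
  have e : ∀ p q : ℝ, (!₂[p, q] : R2)
      = p • EuclideanSpace.single (0 : Fin 2) (1:ℝ) + q • EuclideanSpace.single (1 : Fin 2) (1:ℝ) := by
    intro p q
    ext i
    fin_cases i <;> simp
  have hcurve : HasDerivAt (fun t => (!₂[x t, y t] : R2))
      (x' • EuclideanSpace.single (0 : Fin 2) (1:ℝ) + y' • EuclideanSpace.single (1 : Fin 2) (1:ℝ)) t := by
    simp only [e]
    exact (hx.smul_const _).add (hy.smul_const _)
  have := (hd (!₂[x t, y t] : R2)).hasFDerivAt.comp_hasDerivAt t hcurve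
  refine this.congr_deriv ?_
  simp

lemma norm_polar (t s : ℝ) :
    ‖(!₂[Real.exp t * Real.cos s, Real.exp t * Real.sin s] : R2)‖ = Real.exp t := by
  rw [EuclideanSpace.norm_eq]
  simp only [Fin.sum_univ_two, Real.norm_eq_abs, sq_abs]
  simp only [Matrix.cons_val_zero, Matrix.cons_val_one]
  rw [show (Real.exp t * Real.cos s) ^ 2 + (Real.exp t * Real.sin s) ^ 2 = Real.exp t ^ 2 by
    have := Real.sin_sq_add_cos_sq s
    linear_combination Real.exp t ^ 2 * this]
  exact Real.sqrt_sq (Real.exp_pos t).le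

lemma bdd_ball (g : R2 → ℝ) (hg : Continuous g) (r : ℝ) : ∃ B, 0 < B ∧ ∀ x, ‖x‖ ≤ r → |g x| ≤ B := by
  obtain ⟨B, hB⟩ := (isCompact_closedBall (0 : R2) r).exists_bound_of_continuousOn hg.continuousOn
  refine ⟨max B 1, by positivity, fun x hx => ?_⟩
  exact (hB x (by simpa using hx)).trans (le_max_left _ _)

/-- **Theorem 2.13 (non-existence).**  Let `R` be bounded, continuous and radially
symmetric, positive and non-increasing for `|x| < r₀` and negative for `|x| > r₀`.  Then
for every `η ≥ 4` there is no solution of `−Δu = R e^u` on `ℝ²` with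
`u = −η log|x| + O(1)` as `|x| → ∞`. -/
theorem statement10 (R : R2 → ℝ) (hc : Continuous R) (hbdd : ∃ M : ℝ, ∀ x, |R x| ≤ M)
    (f : ℝ → ℝ) (hrad : ∀ x : R2, R x = f ‖x‖) (r₀ : ℝ) (hr₀ : 0 < r₀)
    (hpos : ∀ s : ℝ, 0 ≤ s → s < r₀ → 0 < f s)
    (hmono : AntitoneOn f (Set.Ico 0 r₀))
    (hneg : ∀ s : ℝ, r₀ < s → f s < 0)
    (η : ℝ) (hη : 4 ≤ η) :
    ¬ ∃ u : R2 → ℝ, IsSolution R u ∧ AsympLog η u := by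
  rintro ⟨u, ⟨hu, hpde⟩, C, hC⟩
  have hud : Differentiable ℝ u := hu.differentiable (by norm_num)
  have hfd : ContDiff ℝ 1 (fderiv ℝ u) := hu.fderiv_right (by norm_num)
  set ux : R2 → ℝ := fun y => fderiv ℝ u y (EuclideanSpace.single 0 1) with hux
  set uy : R2 → ℝ := fun y => fderiv ℝ u y (EuclideanSpace.single 1 1) with huy
  have huxc : ContDiff ℝ 1 ux := hfd.clm_apply contDiff_const
  have huyc : ContDiff ℝ 1 uy := hfd.clm_apply contDiff_const
  have huxd : Differentiable ℝ ux := huxc.differentiable (by norm_num)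
  have huyd : Differentiable ℝ uy := huyc.differentiable (by norm_num)
  set P : ℝ → ℝ → R2 := fun t s => !₂[Real.exp t * Real.cos s, Real.exp t * Real.sin s] with hP
  have hPc : Continuous fun p : ℝ × ℝ => P p.1 p.2 := by
    simp only [hP]
    fun_prop
  have hPn : ∀ t s, ‖P t s‖ = Real.exp t := norm_polar
  have hPp : ∀ t s, P t (s + 2 * π) = P t s := by
    intro t s
    simp only [hP, Real.cos_add_two_pi, Real.sin_add_two_pi]
  have dt : ∀ (h : R2 → ℝ), Differentiable ℝ h → ∀ t s, HasDerivAt (fun t => h (P t s))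
      (Real.exp t * Real.cos s * fderiv ℝ h (P t s) (EuclideanSpace.single 0 1)
        + Real.exp t * Real.sin s * fderiv ℝ h (P t s) (EuclideanSpace.single 1 1)) t :=
    fun h hd t s => curve_deriv h hd (fun t => Real.exp t * Real.cos s)
      (fun t => Real.exp t * Real.sin s) _ _ t ((Real.hasDerivAt_exp t).mul_const _)
      ((Real.hasDerivAt_exp t).mul_const _)
  have ds : ∀ (h : R2 → ℝ), Differentiable ℝ h → ∀ t s, HasDerivAt (fun s => h (P t s))
      (Real.exp t * -Real.sin s * fderiv ℝ h (P t s) (EuclideanSpace.single 0 1)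
        + Real.exp t * Real.cos s * fderiv ℝ h (P t s) (EuclideanSpace.single 1 1)) s :=
    fun h hd t s => curve_deriv h hd (fun s => Real.exp t * Real.cos s)
      (fun s => Real.exp t * Real.sin s) _ _ s ((Real.hasDerivAt_cos s).const_mul _)
      ((Real.hasDerivAt_sin s).const_mul _)
  obtain ⟨B₁, hB₁, hB₁'⟩ := bdd_ball u hud.continuous 1
  refine core (fun t s => u (P t s) + 2 * t)
    (fun t s => (Real.exp t * Real.cos s * ux (P t s) + Real.exp t * Real.sin s * uy (P t s)) + 2)
    (fun t s => Real.exp t * Real.cos s * ux (P t s) + Real.exp t * Real.cos s *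
        (Real.exp t * Real.cos s * fderiv ℝ ux (P t s) (EuclideanSpace.single 0 1)
        + Real.exp t * Real.sin s * fderiv ℝ ux (P t s) (EuclideanSpace.single 1 1))
      + (Real.exp t * Real.sin s * uy (P t s) + Real.exp t * Real.sin s *
        (Real.exp t * Real.cos s * fderiv ℝ uy (P t s) (EuclideanSpace.single 0 1)
        + Real.exp t * Real.sin s * fderiv ℝ uy (P t s) (EuclideanSpace.single 1 1))))
    (fun t s => Real.exp t * -Real.sin s * ux (P t s) + Real.exp t * Real.cos s * uy (P t s))
    (fun t s => Real.exp t * -Real.cos s * ux (P t s) + Real.exp t * -Real.sin s *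
        (Real.exp t * -Real.sin s * fderiv ℝ ux (P t s) (EuclideanSpace.single 0 1)
        + Real.exp t * Real.cos s * fderiv ℝ ux (P t s) (EuclideanSpace.single 1 1))
      + (Real.exp t * -Real.sin s * uy (P t s) + Real.exp t * Real.cos s *
        (Real.exp t * -Real.sin s * fderiv ℝ uy (P t s) (EuclideanSpace.single 0 1)
        + Real.exp t * Real.cos s * fderiv ℝ uy (P t s) (EuclideanSpace.single 1 1))))
    (fun t => f (Real.exp t)) (Real.log r₀) (max C B₁)
    ?_ ?_ ?_ ?_ ?_ ?_ ?_ ?_ ?_ ?_ ?_ ?_ ?_ ?_ ?_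
  · exact (hud.continuous.comp hPc).add (by fun_prop)
  · have c1 := huxd.continuous.comp hPc
    have c2 := huyd.continuous.comp hPc
    simp only [Function.comp_def] at c1 c2
    fun_prop
  · intro t s; simp only [hPp]
  · intro t s; simp only [hPp, Real.cos_add_two_pi, Real.sin_add_two_pi]
  · intro t s
    exact ((dt u hud t s).add ((hasDerivAt_id t).const_mul 2)).congr_deriv (by simp [hux, huy])
  · intro t s
    exact (((((Real.hasDerivAt_exp t).mul_const (Real.cos s)).mul (dt ux huxd t s)).add
      (((Real.hasDerivAt_exp t).mul_const (Real.sin s)).mul (dt uy huyd t s))).add_const 2)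
  · intro t s
    exact (ds u hud t s).add_const _
  · intro t s
    exact (((((Real.hasDerivAt_sin s).neg).const_mul (Real.exp t)).mul (ds ux huxd t s)).add
      (((Real.hasDerivAt_cos s).const_mul (Real.exp t)).mul (ds uy huyd t s)))
  · intro t s
    have e := hpde (P t s)
    have e2 : lapR2 u (P t s) = fderiv ℝ ux (P t s) (EuclideanSpace.single 0 1)
        + fderiv ℝ uy (P t s) (EuclideanSpace.single 1 1) := by
      simp only [lapR2, Fin.sum_univ_two, hux, huy]
    rw [hrad, hPn, e2] at e
    have e3 : Real.exp (u (P t s) + 2 * t) = Real.exp (u (P t s)) * Real.exp t ^ 2 := by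
      rw [Real.exp_add, ← Real.exp_nat_mul]; norm_num
    simp only [e3]
    have hsc := Real.sin_sq_add_cos_sq s
    linear_combination (-(Real.exp t ^ 2)) * e +
      Real.exp t ^ 2 * (fderiv ℝ ux (P t s) (EuclideanSpace.single 0 1)
        + fderiv ℝ uy (P t s) (EuclideanSpace.single 1 1)) * hsc
  · intro t ht
    exact hpos _ (Real.exp_pos t).le ((Real.lt_log_iff_exp_lt hr₀).1 ht)
  · intro t ht
    have hle : r₀ ≤ Real.exp t := (Real.log_le_iff_le_exp hr₀).1 ht
    have hcont : Continuous fun σ : ℝ => R (P σ 0) :=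
      hc.comp (hPc.comp (by fun_prop : Continuous fun σ : ℝ => (σ, (0:ℝ))))
    have hlim : Tendsto (fun σ : ℝ => R (P σ 0)) (𝓝[>] t) (𝓝 (R (P t 0))) :=
      (hcont.tendsto t).mono_left nhdsWithin_le_nhds
    rw [hrad, hPn] at hlim
    refine le_of_tendsto hlim ?_
    filter_upwards [self_mem_nhdsWithin] with σ hσ
    rw [hrad, hPn]
    exact (hneg _ (hle.trans_lt (Real.exp_lt_exp.2 hσ))).le
  · intro s t hst ht
    have h1 : Real.exp t < r₀ := (Real.lt_log_iff_exp_lt hr₀).1 ht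
    have h2 : Real.exp s ≤ Real.exp t := Real.exp_le_exp.2 hst
    exact hmono ⟨(Real.exp_pos s).le, h2.trans_lt h1⟩ ⟨(Real.exp_pos t).le, h1⟩ h2
  · intro t s
    show u (P t s) + 2 * t ≤ max C B₁ - 2 * t
    have m1 := le_max_left C B₁
    have m2 := le_max_right C B₁
    rcases le_total 0 t with h | h
    · have := hC (P t s) (by rw [hPn]; exact Real.one_le_exp h)
      rw [hPn, Real.log_exp] at this
      have := (abs_le.1 this).2
      nlinarith
    · have := hB₁' (P t s) (by rw [hPn]; exact Real.exp_le_one_iff.2 h)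
      have := (abs_le.1 this).2
      linarith
  · intro a
    obtain ⟨D, _, hD⟩ := bdd_ball u hud.continuous (Real.exp a)
    refine ⟨D, fun t ht s => ?_⟩
    have := hD (P t s) (by rw [hPn]; exact Real.exp_le_exp.2 ht)
    have := (abs_le.1 this).1
    show 2 * t - D ≤ u (P t s) + 2 * t
    linarith
  · obtain ⟨X, hX, hX'⟩ := bdd_ball ux huxd.continuous 1
    obtain ⟨Y, hY, hY'⟩ := bdd_ball uy huyd.continuous 1
    refine ⟨min 0 (Real.log (1 / (X + Y))), fun t ht s => ?_⟩
    have h0 : Real.exp t ≤ 1 := Real.exp_le_one_iff.2 (ht.trans (min_le_left _ _))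
    have h1 : Real.exp t ≤ 1 / (X + Y) :=
      (Real.le_log_iff_exp_le (by positivity)).1 (ht.trans (min_le_right _ _))
    rw [le_div_iff₀ (by positivity)] at h1
    have b1 : |Real.cos s * ux (P t s)| ≤ X := by
      rw [abs_mul]
      exact (mul_le_mul (Real.abs_cos_le_one s) (hX' _ (by rw [hPn]; exact h0)) (abs_nonneg _)
        zero_le_one).trans (by linarith)
    have b2 : |Real.sin s * uy (P t s)| ≤ Y := by
      rw [abs_mul]
      exact (mul_le_mul (Real.abs_sin_le_one s) (hY' _ (by rw [hPn]; exact h0)) (abs_nonneg _)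
        zero_le_one).trans (by linarith)
    have b3 := (abs_le.1 b1).1
    have b4 := (abs_le.1 b2).1
    have b5 := mul_le_mul_of_nonneg_left (add_le_add b3 b4) (Real.exp_pos t).le
    show 0 < (Real.exp t * Real.cos s * ux (P t s) + Real.exp t * Real.sin s * uy (P t s)) + 2
    nlinarith

end
end
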